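/- Let a₁, a₂ > 0 with a₁ ≠ a₂ and ω ∈ ℝ. Then the function w ↦ −e^{−w²/2} e^{−iωw}/((w − ia₁)(w − ia₂)) is integrable on ℝ and ∫_ℝ −e^{−w²/2} e^{−iωw} ((w − ia₁)(w − ia₂))^{−1} dw = √(2π) e^{−ω²/2} (φ(ω+a₂) − φ(ω+a₁))/(a₁ − a₂). -/

import Mathlib

open MeasureTheory

/-- The Gaussian tail function `Φ^c(w) = (2π)^{-1/2} ∫_w^∞ e^{−s²/2} ds`. -/
noncomputable def Phic (w : ℝ) : ℝ :=
  (1 / Real.sqrt (2 * Real.pi)) * ∫ s in Set.Ioi w, Real.exp (-s ^ 2 / 2)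

/-- `φ(w) = √(2π) e^{w²/2} Φ^c(w)`. -/
noncomputable def phifun (w : ℝ) : ℝ :=
  Real.sqrt (2 * Real.pi) * Real.exp (w ^ 2 / 2) * Phic w

lemma aux_gauss_int : Integrable (fun w : ℝ => Real.exp (-w ^ 2 / 2)) := by
  have := integrable_exp_neg_mul_sq (b := 1 / 2) (by norm_num)
  refine this.congr (Filter.Eventually.of_forall fun w => ?_)
  simp only
  congr 1
  ring

lemma aux_ne (a : ℝ) (ha : 0 < a) (w : ℝ) : ((w : ℂ) - Complex.I * a) ≠ 0 := by
  intro h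
  have := congrArg Complex.im h
  simp at this
  exact ha.ne' this

lemma aux_integrable (a ω : ℝ) (ha : 0 < a) :
    Integrable (fun w : ℝ =>
      (Real.exp (-w ^ 2 / 2) * Complex.exp (-Complex.I * ω * w)) / ((w : ℂ) - Complex.I * a)) := by
  refine (aux_gauss_int.mul_const a⁻¹).mono' ?_ (Filter.Eventually.of_forall fun w => ?_)
  · apply Continuous.aestronglyMeasurable
    apply Continuous.div
    · fun_prop
    · fun_prop
    · exact aux_ne a ha
  · rw [norm_div, norm_mul, Complex.norm_real, Complex.norm_exp, Real.norm_of_nonneg (by positivity)]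
    have h0 : (-Complex.I * ω * w).re = 0 := by simp
    rw [h0, Real.exp_zero, mul_one, div_eq_mul_inv]
    gcongr
    have := Complex.abs_im_le_norm ((w : ℂ) - Complex.I * a)
    simp at this
    exact (le_abs_self a).trans this

lemma aux_inner (ω t : ℝ) :
    ∫ w : ℝ, (Real.exp (-w ^ 2 / 2) : ℂ) * Complex.exp (-Complex.I * (ω + t) * w)
      = ((Real.sqrt (2 * Real.pi) * Real.exp (-(ω + t) ^ 2 / 2) : ℝ) : ℂ) := by
  have h := fourierIntegral_gaussian (b := 1 / 2) (by norm_num) (-((ω : ℂ) + t))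
  have e1 : ∀ w : ℝ, (Real.exp (-w ^ 2 / 2) : ℂ) * Complex.exp (-Complex.I * (ω + t) * w)
      = Complex.exp (Complex.I * (-((ω : ℂ) + t)) * w) * Complex.exp (-(1 / 2) * (w : ℂ) ^ 2) := by
    intro w
    push_cast
    rw [mul_comm]
    congr 2 <;> ring
  simp_rw [e1]
  rw [h]
  push_cast
  congr 1
  · rw [Real.sqrt_eq_rpow, Complex.ofReal_cpow (by positivity)]
    push_cast
    congr 1
    ring
  · congr 1
    ring

lemma aux_shift (f : ℝ → ℝ) (c : ℝ) :
    ∫ t in Set.Ioi 0, f (t + c) = ∫ s in Set.Ioi c, f s := by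
  have := (measurePreserving_add_right volume c).setIntegral_preimage_emb
    (measurableEmbedding_addRight c) f (Set.Ioi c)
  simpa using this

lemma aux_single (a ω : ℝ) (ha : 0 < a) :
    (∫ w : ℝ,
      (Real.exp (-w ^ 2 / 2) * Complex.exp (-Complex.I * ω * w)) / ((w : ℂ) - Complex.I * a))
    = Complex.I * ((Real.sqrt (2 * Real.pi) * Real.exp (-ω ^ 2 / 2) * phifun (ω + a) : ℝ) : ℂ) := by
  let F : ℝ → ℝ → ℂ := fun w t =>
    (Real.exp (-w ^ 2 / 2) * Complex.exp (-Complex.I * ω * w)) *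
      Complex.exp ((-(a + Complex.I * w)) * t)
  have hF : Integrable (Function.uncurry F) (volume.prod (volume.restrict (Set.Ioi (0 : ℝ)))) := by
    have hp := aux_gauss_int.mul_prod (integrableOn_exp_mul_Ioi (neg_lt_zero.2 ha) 0)
    refine hp.mono' ?_ (Filter.Eventually.of_forall ?_)
    · apply Continuous.aestronglyMeasurable
      simp only [F, Function.uncurry_def]
      fun_prop
    · rintro ⟨w, t⟩
      simp only [F, Function.uncurry]
      rw [norm_mul, norm_mul, Complex.norm_real, Complex.norm_exp, Complex.norm_exp,
        Real.norm_of_nonneg (by positivity)]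
      simp
  have e1 : ∀ w : ℝ,
      (Real.exp (-w ^ 2 / 2) * Complex.exp (-Complex.I * ω * w)) / ((w : ℂ) - Complex.I * a)
      = Complex.I * ∫ t in Set.Ioi (0 : ℝ), F w t := by
    intro w
    simp only [F]
    rw [integral_const_mul, integral_exp_mul_complex_Ioi (by simpa using ha)]
    have h1 := aux_ne a ha w
    have h2 : (w : ℂ) - Complex.I * a = -Complex.I * (a + Complex.I * w) := by
      linear_combination (w : ℂ) * Complex.I_mul_I
    have h3 : (a + Complex.I * w : ℂ) ≠ 0 := by
      intro h; rw [h2, h] at h1; simp at h1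
    rw [h2]
    simp only [Complex.ofReal_zero, mul_zero, Complex.exp_zero]
    have hI := Complex.I_ne_zero
    field_simp
    rw [Complex.I_sq]
  simp_rw [e1]
  rw [integral_const_mul, integral_integral_swap hF]
  congr 1
  have e2 : ∀ t : ℝ, ∫ w, F w t = (((Real.sqrt (2 * Real.pi) * Real.exp (-ω ^ 2 / 2) *
      Real.exp ((ω + a) ^ 2 / 2)) * Real.exp (-(t + (ω + a)) ^ 2 / 2) : ℝ) : ℂ) := by
    intro t
    have : ∀ w, F w t = Complex.exp (-a * t) *
        ((Real.exp (-w ^ 2 / 2) : ℂ) * Complex.exp (-Complex.I * (ω + t) * w)) := by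
      intro w
      simp only [F]
      push_cast
      simp only [← Complex.exp_add]
      congr 1
      ring
    simp_rw [this]
    rw [integral_const_mul, aux_inner]
    have h5 : Complex.exp (-a * t) = ((Real.exp (-a * t) : ℝ) : ℂ) := by push_cast; rfl
    rw [h5, ← Complex.ofReal_mul]
    congr 1
    have h6 : Real.exp (-a * t) * Real.exp (-(ω + t) ^ 2 / 2) = Real.exp (-ω ^ 2 / 2) *
      Real.exp ((ω + a) ^ 2 / 2) * Real.exp (-(t + (ω + a)) ^ 2 / 2) := by
      simp only [← Real.exp_add]
      congr 1
      ring
    linear_combination Real.sqrt (2 * Real.pi) * h6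
  simp_rw [e2]
  rw [integral_complex_ofReal, integral_const_mul,
    aux_shift (fun s => Real.exp (-s ^ 2 / 2)) (ω + a)]
  congr 1
  unfold phifun Phic
  have : Real.sqrt (2 * Real.pi) ≠ 0 := by positivity
  field_simp

/-- The Fourier transform of a Gaussian times a double simple-pole factor
(proof of Lemma 3.2 of the paper). -/
theorem stmt12 (a₁ a₂ : ℝ) (h1 : 0 < a₁) (h2 : 0 < a₂) (hne : a₁ ≠ a₂) (ω : ℝ) :
    Integrable (fun w : ℝ =>
      -(Real.exp (-w ^ 2 / 2) * Complex.exp (-Complex.I * ω * w)) /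
        (((w : ℂ) - Complex.I * a₁) * ((w : ℂ) - Complex.I * a₂))) ∧
    (∫ w : ℝ, -(Real.exp (-w ^ 2 / 2) * Complex.exp (-Complex.I * ω * w)) /
        (((w : ℂ) - Complex.I * a₁) * ((w : ℂ) - Complex.I * a₂))) =
      ((Real.sqrt (2 * Real.pi) * Real.exp (-ω ^ 2 / 2) *
        ((phifun (ω + a₂) - phifun (ω + a₁)) / (a₁ - a₂)) : ℝ) : ℂ) := by
  have hd : (a₁ : ℂ) - a₂ ≠ 0 := by
    rw [sub_ne_zero]; exact_mod_cast hne
  have hI := Complex.I_ne_zero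
  have e : ∀ w : ℝ, -(Real.exp (-w ^ 2 / 2) * Complex.exp (-Complex.I * ω * w)) /
        (((w : ℂ) - Complex.I * a₁) * ((w : ℂ) - Complex.I * a₂)) =
      (Complex.I * (a₁ - a₂))⁻¹ *
      ((Real.exp (-w ^ 2 / 2) * Complex.exp (-Complex.I * ω * w)) / ((w : ℂ) - Complex.I * a₂) -
      (Real.exp (-w ^ 2 / 2) * Complex.exp (-Complex.I * ω * w)) / ((w : ℂ) - Complex.I * a₁)) := by
    intro w
    have n1 := aux_ne a₁ h1 w
    have n2 := aux_ne a₂ h2 w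
    rw [div_sub_div _ _ n2 n1, inv_mul_eq_div, div_div, div_eq_div_iff (by positivity) (by positivity)]
    ring
  simp_rw [e]
  have i1 := aux_integrable a₁ ω h1
  have i2 := aux_integrable a₂ ω h2
  refine ⟨(i2.sub i1).const_mul _, ?_⟩
  rw [integral_const_mul, integral_sub i2 i1, aux_single a₁ ω h1, aux_single a₂ ω h2]
  push_cast
  field_simp
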